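/- Let Γ be a finite simple graph. Suppose there exist a family F of subgraphs of Γ and a subset E of the edge set of Γ such that: (i) Γ is the union of the subgraphs in F; (ii) each subgraph Σ ∈ F is a generalized closed ladder in which every edge of E(Σ) ∩ E is a rung of Σ, and moreover |E(Σ) ∩ E| ≥ 2 whenever Σ does not admit a nowhere-zero 3-flow; and (iii) each edge in E is a rung of at least two distinct subgraphs in F, and each edge of Γ not in E is contained in exactly one subgraph in F. Then Γ admits a nowhere-zero 3-flow. -/

import Mathlib

/-- A nowhere-zero 3-flow on a finite simple graph. -/
def HasNowhereZero3Flow {V : Type*} [Fintype V] (G : SimpleGraph V) : Prop :=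
  ∃ f : V → V → ℤ,
    (∀ u v, f u v = - f v u) ∧
    (∀ u v, ¬ G.Adj u v → f u v = 0) ∧
    (∀ u v, G.Adj u v → 0 < |f u v| ∧ |f u v| < 3) ∧
    ∀ u, ∑ v, f u v = 0

/-- Canonical model of a generalized circular ladder with `n` rungs: two disjoint
cycles `ZMod m₀` and `ZMod m₁` together with `n` rungs joining the attachment point
`A k` on the first cycle to the attachment point `B k` on the second one. -/
def genCircularModel (n m₀ m₁ : ℕ) (A B : Fin n → ℕ) :
    SimpleGraph (ZMod m₀ ⊕ ZMod m₁) :=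
  SimpleGraph.fromRel (fun p q =>
    match p, q with
    | Sum.inl i, Sum.inl j => j = i + 1
    | Sum.inr i, Sum.inr j => j = i + 1
    | Sum.inl i, Sum.inr j => ∃ k : Fin n, i = ((A k : ℕ) : ZMod m₀) ∧ j = ((B k : ℕ) : ZMod m₁)
    | Sum.inr _, Sum.inl _ => False)

/-- `Γ` is a generalized circular ladder with rung set `R`: there is an embedding of a
canonical model (two cycles of lengths `m₀, m₁ ≥ 3` with `n` rungs attached at strictly
increasing positions `A`, `B` in matching cyclic order) onto the edges of `Γ`, carrying
the model rungs exactly onto `R`.  The cases `n = 0` and `n = 1` are the disjoint union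
of two cycles and two cycles joined by one edge, respectively. -/
def IsGenCircularLadder {V : Type*} (Γ : SimpleGraph V) (R : Set (Sym2 V)) : Prop :=
  ∃ (n m₀ m₁ : ℕ) (A B : Fin n → ℕ) (ψ : (ZMod m₀ ⊕ ZMod m₁) ↪ V),
    3 ≤ m₀ ∧ 3 ≤ m₁ ∧
    StrictMono A ∧ StrictMono B ∧ (∀ k, A k < m₀) ∧ (∀ k, B k < m₁) ∧
    (∀ x y, Γ.Adj (ψ x) (ψ y) ↔ (genCircularModel n m₀ m₁ A B).Adj x y) ∧
    (∀ u w, Γ.Adj u w → ∃ x y, u = ψ x ∧ w = ψ y) ∧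
    R = {e : Sym2 V | ∃ k : Fin n,
      e = s(ψ (Sum.inl ((A k : ℕ) : ZMod m₀)), ψ (Sum.inr ((B k : ℕ) : ZMod m₁)))}

/-- Canonical model of a generalized Möbius ladder with `n` rungs: one cycle `ZMod m`
with `2n` attachment points `A 0 < ⋯ < A (n-1) < B 0 < ⋯ < B (n-1)` and `n` rungs
joining `A k` to `B k`. -/
def genMobiusModel (n m : ℕ) (A B : Fin n → ℕ) : SimpleGraph (ZMod m) :=
  SimpleGraph.fromRel (fun i j =>
    j = i + 1 ∨ ∃ k : Fin n, i = ((A k : ℕ) : ZMod m) ∧ j = ((B k : ℕ) : ZMod m))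

/-- `Γ` is a generalized Möbius ladder with rung set `R`: there is an embedding of a
canonical model (a cycle of length `m ≥ 3` with rungs joining `A k` to `B k`, the `2n`
attachment points being in the cyclic order `A 0, …, A (n-1), B 0, …, B (n-1)`, and each
rung joining points at cyclic distance at least two) onto the edges of `Γ`, carrying the
model rungs exactly onto `R`.  The cases `n = 0` and `n = 1` are a cycle and a cycle
with a chord, respectively. -/
def IsGenMobiusLadder {V : Type*} (Γ : SimpleGraph V) (R : Set (Sym2 V)) : Prop :=
  ∃ (n m : ℕ) (A B : Fin n → ℕ) (ψ : ZMod m ↪ V),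
    3 ≤ m ∧ StrictMono A ∧ StrictMono B ∧
    (∀ k l, A k < B l) ∧ (∀ k, B k < m) ∧
    (∀ k, A k + 2 ≤ B k ∧ B k + 2 ≤ m + A k) ∧
    (∀ x y, Γ.Adj (ψ x) (ψ y) ↔ (genMobiusModel n m A B).Adj x y) ∧
    (∀ u w, Γ.Adj u w → ∃ x y, u = ψ x ∧ w = ψ y) ∧
    R = {e : Sym2 V | ∃ k : Fin n,
      e = s(ψ ((A k : ℕ) : ZMod m), ψ ((B k : ℕ) : ZMod m))}

/-- A generalized closed ladder is a generalized circular or Möbius ladder. -/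
def IsGenClosedLadder {V : Type*} (Γ : SimpleGraph V) (R : Set (Sym2 V)) : Prop :=
  IsGenCircularLadder Γ R ∨ IsGenMobiusLadder Γ R

/-- `g` is a (not necessarily nowhere-zero) flow on `G` with values in `ZMod 3`. -/
structure IsModFlowOn {V : Type*} [Fintype V] (G : SimpleGraph V) (g : V → V → ZMod 3) :
    Prop where
  antisymm : ∀ u v, g u v = - g v u
  eq_zero : ∀ u v, ¬ G.Adj u v → g u v = 0
  sum_eq_zero : ∀ u, ∑ v, g u v = 0

open Classical in
/-- A conserved weight on a system of oriented edges of `G` extends to a flow on `G`. -/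
theorem exists_isModFlowOn_of_arcs {V α : Type*} [Fintype V] [Fintype α] {G : SimpleGraph V}
    {t h : α → V} (hinj : Function.Injective fun a => s(t a, h a))
    (hadj : ∀ u v, G.Adj u v ↔ ∃ a, s(t a, h a) = s(u, v)) (c : α → ZMod 3)
    (hc : ∀ φ : V → ZMod 3, ∑ a, c a * (φ (t a) - φ (h a)) = 0) :
    ∃ g, IsModFlowOn G g ∧ ∀ a, g (t a) (h a) = c a := by
  refine ⟨fun u v => ∑ a, c a * ((if t a = u ∧ h a = v then 1 else 0) -
    (if t a = v ∧ h a = u then 1 else 0)), ⟨fun u v => ?_, fun u v huv => ?_, fun u => ?_⟩,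
    fun a => ?_⟩
  · rw [← Finset.sum_neg_distrib]
    exact Finset.sum_congr rfl fun a _ => by ring
  · refine Finset.sum_eq_zero fun a _ => ?_
    have h1 : ¬ (t a = u ∧ h a = v) := fun ⟨e1, e2⟩ => huv ((hadj u v).2 ⟨a, by rw [e1, e2]⟩)
    have h2 : ¬ (t a = v ∧ h a = u) :=
      fun ⟨e1, e2⟩ => huv ((hadj u v).2 ⟨a, by rw [e1, e2, Sym2.eq_swap]⟩)
    simp [h1, h2]
  · rw [Finset.sum_comm]
    refine Eq.trans ?_ (hc fun w => if w = u then 1 else 0)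
    refine Finset.sum_congr rfl fun a _ => ?_
    rw [← Finset.mul_sum, Finset.sum_sub_distrib]
    congr 2
    · by_cases e : t a = u <;> simp [e]
    · by_cases e : h a = u <;> simp [e]
  · have hne : t a ≠ h a := ((hadj _ _).2 ⟨a, rfl⟩).ne
    change ∑ b, c b * _ = _
    rw [Finset.sum_eq_single a]
    · simp [hne]
    · intro b _ hb
      have h1 : ¬ (t b = t a ∧ h b = h a) := fun ⟨e1, e2⟩ => hb (hinj (by simp only [e1, e2]))
      have h2 : ¬ (t b = h a ∧ h b = t a) :=
        fun ⟨e1, e2⟩ => hb (hinj (by simp only [e1, e2, Sym2.eq_swap]))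
      simp [h1, h2]
    · simp

/-- A presentation of a graph by oriented rails and rungs, in which any nonzero prescription
on the rungs can be avoided by a flow that vanishes on no rail. -/
def HasRungAvoidingPresentation {V : Type*} (G : SimpleGraph V) (R : Set (Sym2 V)) : Prop :=
  ∃ (ρ : Type) (_ : Fintype ρ) (n : ℕ) (t h : ρ ⊕ Fin n → V),
    (Function.Injective fun a => s(t a, h a)) ∧
    (∀ u v, G.Adj u v ↔ ∃ a, s(t a, h a) = s(u, v)) ∧
    (R = {e | ∃ k, e = s(t (Sum.inr k), h (Sum.inr k))}) ∧
    ∀ (s : Fin n → ZMod 3) (k₀ : Fin n), s k₀ ≠ 0 → ∃ c : ρ ⊕ Fin n → ZMod 3,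
      (∀ φ : V → ZMod 3, ∑ a, c a * (φ (t a) - φ (h a)) = 0) ∧
      (∀ i, c (Sum.inl i) ≠ 0) ∧ ∀ k, c (Sum.inr k) + s k ≠ 0

open Classical in
theorem HasRungAvoidingPresentation.exists_flow {V : Type*} [Fintype V] {G : SimpleGraph V}
    {R E : Set (Sym2 V)} (hG : HasRungAvoidingPresentation G R) (hE : G.edgeSet ∩ E ⊆ R)
    {s : V → V → ZMod 3} (hs : ∀ u v, s u v = - s v u)
    (hne : ∃ u v, G.Adj u v ∧ s(u, v) ∈ E ∧ s u v ≠ 0) :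
    ∃ g, IsModFlowOn G g ∧ (∀ u v, G.Adj u v → s(u, v) ∉ E → g u v ≠ 0) ∧
      ∀ u v, G.Adj u v → s(u, v) ∈ E → s u v + g u v ≠ 0 := by
  obtain ⟨ρ, _, n, t, h, hinj, hadj, rfl, hflow⟩ := hG
  obtain ⟨u₀, v₀, huv₀, he₀, hs₀⟩ := hne
  have hswap : ∀ {u v w x : V}, s(u, v) = s(w, x) → s w x ≠ 0 → s u v ≠ 0 := by
    intro u v w x e hx
    rcases Sym2.eq_iff.1 e with ⟨rfl, rfl⟩ | ⟨rfl, rfl⟩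
    · exact hx
    · rw [hs]; exact neg_ne_zero.2 hx
  obtain ⟨k₀, hk₀⟩ := hE ⟨huv₀, he₀⟩
  obtain ⟨c, hc, hrail, hrung⟩ := hflow
    (fun k => if s(t (.inr k), h (.inr k)) ∈ E then s (t (.inr k)) (h (.inr k)) else 0) k₀
    (by rw [if_pos (hk₀ ▸ he₀)]; exact hswap hk₀.symm hs₀)
  obtain ⟨g, hg, hgc⟩ := exists_isModFlowOn_of_arcs hinj hadj c hc
  have key : ∀ a, (s(t a, h a) ∉ E → g (t a) (h a) ≠ 0) ∧
      (s(t a, h a) ∈ E → s (t a) (h a) + g (t a) (h a) ≠ 0) := by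
    rintro (i | k)
    · refine ⟨fun _ => hgc _ ▸ hrail i, fun hi => ?_⟩
      obtain ⟨k, hk⟩ := hE ⟨(hadj _ _).2 ⟨.inl i, rfl⟩, hi⟩
      cases hinj hk
    · have := hrung k
      rw [hgc]
      refine ⟨fun hk => ?_, fun hk => ?_⟩
      · simpa [hk] using this
      · simpa [hk, add_comm] using this
  refine ⟨g, hg, fun u v huv he => ?_, fun u v huv he => ?_⟩
  · obtain ⟨a, ha⟩ := (hadj u v).1 huv
    have := (key a).1 (ha ▸ he)
    rcases Sym2.eq_iff.1 ha with ⟨rfl, rfl⟩ | ⟨rfl, rfl⟩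
    · exact this
    · rw [hg.antisymm]; exact neg_ne_zero.2 this
  · obtain ⟨a, ha⟩ := (hadj u v).1 huv
    have := (key a).2 (ha ▸ he)
    rcases Sym2.eq_iff.1 ha with ⟨rfl, rfl⟩ | ⟨rfl, rfl⟩
    · exact this
    · rw [hg.antisymm, hs, ← neg_add]; exact neg_ne_zero.2 this

/-- A nowhere-zero sequence in `ZMod 3` whose increments avoid prescribed values, at least one
of them nonzero, can be chosen to return to plus or minus its initial value. -/
theorem exists_seq_avoiding_increments (s : ℕ → ZMod 3) {n k₀ : ℕ} (hk₀ : k₀ < n)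
    (hs : s k₀ ≠ 0) {δ : ZMod 3} (hδ : δ ≠ 0) :
    ∃ q : ℕ → ZMod 3, (∀ p, q p ≠ 0) ∧ q n = δ * q 0 ∧ ∀ k, q k - q (k + 1) + s k ≠ 0 := by
  have hcases : ∀ x : ZMod 3, x ≠ 0 → x = 1 ∨ x = -1 := by decide
  set τ : ℕ → ZMod 3 := fun k => if s k = 0 then -1 else 1 with hτ
  have hτ0 : ∀ k, τ k ≠ 0 := by
    intro k
    simp only [hτ]
    split_ifs <;> decide
  by_cases hprod : ∏ k ∈ Finset.range n, τ k = δ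
  · refine ⟨fun p => ∏ k ∈ Finset.range p, τ k, fun p => Finset.prod_ne_zero_iff.2
      fun k _ => hτ0 k, by simp [hprod], fun k => ?_⟩
    have h0 : ∏ j ∈ Finset.range k, τ j ≠ 0 := Finset.prod_ne_zero_iff.2 fun k _ => hτ0 k
    simp only [Finset.prod_range_succ]
    generalize ∏ j ∈ Finset.range k, τ j = x at h0 ⊢
    simp only [hτ]
    generalize s k = y
    revert x y
    decide
  · set τ' : ℕ → ZMod 3 := Function.update τ k₀ (-1) with hτ'
    have hτ'0 : ∀ k, τ' k ≠ 0 := by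
      intro k
      by_cases h : k = k₀
      · subst h; rw [hτ', Function.update_self]; decide
      · rw [hτ', Function.update_of_ne h]; exact hτ0 k
    have hP : ∀ p, ∏ k ∈ Finset.range p, τ' k ≠ 0 :=
      fun p => Finset.prod_ne_zero_iff.2 fun k _ => hτ'0 k
    have hprod' : ∏ k ∈ Finset.range n, τ' k = δ := by
      have h1 : ∏ k ∈ Finset.range n, τ' k = - ∏ k ∈ Finset.range n, τ k := by
        rw [hτ', Finset.prod_update_of_mem (Finset.mem_range.2 hk₀),
          ← Finset.mul_prod_erase _ τ (Finset.mem_range.2 hk₀), Finset.sdiff_singleton_eq_erase]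
        have : τ k₀ = 1 := by simp [hτ, hs]
        rw [this]; ring
      rw [h1]
      have h2 : ∏ k ∈ Finset.range n, τ k ≠ 0 := Finset.prod_ne_zero_iff.2 fun k _ => hτ0 k
      generalize ∏ k ∈ Finset.range n, τ k = x at *
      clear h1
      revert x δ
      decide
    set ε : ZMod 3 := - s k₀ * ∏ k ∈ Finset.range k₀, τ' k with hε
    have hε0 : ε ≠ 0 := mul_ne_zero (neg_ne_zero.2 hs) (hP _)
    refine ⟨fun p => ε * ∏ k ∈ Finset.range p, τ' k, fun p => mul_ne_zero hε0 (hP p),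
      by simp [hprod', mul_comm], fun k => ?_⟩
    have h0 := hP k
    simp only [Finset.prod_range_succ]
    by_cases h : k = k₀
    · subst h
      simp only [hε, hτ', Function.update_self]
      rw [← hτ']
      generalize ∏ j ∈ Finset.range k, τ' j = x at h0 ⊢
      generalize s k = y at hs ⊢
      clear * - hs h0
      revert x y
      decide
    · rw [show τ' k = τ k by rw [hτ', Function.update_of_ne h], ← mul_assoc]
      have h1 : ε * ∏ j ∈ Finset.range k, τ' j ≠ 0 := mul_ne_zero hε0 h0
      generalize ε * ∏ j ∈ Finset.range k, τ' j = x at h1 ⊢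
      simp only [hτ]
      generalize s k = y
      clear * - h1
      revert x y
      decide

/-- The sum of the increments of `q` over a set of positions cut out by a monotone function
telescopes. -/
theorem exists_sum_increments_eq (q : ℕ → ZMod 3) (t : ℕ) : ∀ {n : ℕ} {A : Fin n → ℕ},
    Monotone A → ∃ p, ∑ k, (if A k < t then q k - q (k + 1) else 0) = q 0 - q p
  | 0, _, _ => ⟨0, by simp⟩
  | n + 1, A, hA => by
    by_cases h : A (Fin.last n) < t
    · refine ⟨n + 1, ?_⟩
      rw [Finset.sum_congr rfl fun k _ => if_pos ((hA (Fin.le_last k)).trans_lt h),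
        Fin.sum_univ_eq_sum_range (fun k => q k - q (k + 1)) (n + 1),
        Finset.sum_range_sub']
    · obtain ⟨p, hp⟩ := exists_sum_increments_eq q t (A := fun k : Fin n => A k.castSucc)
        (hA.comp Fin.strictMono_castSucc.monotone)
      refine ⟨p, ?_⟩
      rw [Fin.sum_univ_castSucc, if_neg h, add_zero]
      simpa using hp

theorem sum_increments (q : ℕ → ZMod 3) (n : ℕ) :
    ∑ k : Fin n, (q k - q (k + 1)) = q 0 - q n := by
  rw [Fin.sum_univ_eq_sum_range (fun k => q k - q (k + 1)) n, Finset.sum_range_sub']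

theorem sum_zmod_eq_sum_range {m : ℕ} [NeZero m] (f : ZMod m → ℕ → ZMod 3) :
    ∑ i : ZMod m, f i i.val = ∑ t ∈ Finset.range m, f t t := by
  refine Finset.sum_bij' (fun i _ => i.val) (fun t _ => (t : ZMod m)) ?_ ?_ ?_ ?_ ?_
  · intro i _; exact Finset.mem_range.2 (ZMod.val_lt i)
  · intros; exact Finset.mem_univ _
  · intro i _; exact ZMod.natCast_zmod_val i
  · intro t ht; exact ZMod.val_cast_of_lt (Finset.mem_range.1 ht)
  · intro i _; simp

theorem sum_zmod_sub_succ_of_lt {m : ℕ} [NeZero m] (φ : ZMod m → ZMod 3) {a : ℕ} (ha : a ≤ m) :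
    ∑ i : ZMod m, (if a < i.val + 1 then φ i - φ (i + 1) else 0) = φ a - φ 0 := by
  rw [sum_zmod_eq_sum_range fun i t => if a < t + 1 then φ i - φ (i + 1) else 0,
    ← Finset.sum_range_add_sum_Ico _ ha, Finset.sum_eq_zero, zero_add]
  · rw [Finset.sum_congr rfl fun t ht => if_pos (Nat.lt_succ_of_le (Finset.mem_Ico.1 ht).1)]
    have := Finset.sum_Ico_sub (fun t : ℕ => -φ t) ha
    simpa [neg_add_eq_sub] using this
  · intro t ht
    exact if_neg (by have := Finset.mem_range.1 ht; omega)

theorem sum_zmod_partialSum_mul {m n : ℕ} [NeZero m] (φ : ZMod m → ZMod 3) {A : Fin n → ℕ}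
    (hA : ∀ k, A k < m) (r : Fin n → ZMod 3) :
    ∑ i : ZMod m, (∑ k, if A k < i.val + 1 then r k else 0) * (φ i - φ (i + 1)) =
      ∑ k, r k * (φ (A k) - φ 0) := by
  simp only [Finset.sum_mul]
  rw [Finset.sum_comm]
  refine Finset.sum_congr rfl fun k _ => ?_
  rw [← sum_zmod_sub_succ_of_lt φ (hA k).le, Finset.mul_sum]
  exact Finset.sum_congr rfl fun i _ => by split_ifs <;> simp

theorem sum_zmod_const_mul {m : ℕ} [NeZero m] (φ : ZMod m → ZMod 3) (x : ZMod 3) :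
    ∑ i : ZMod m, x * (φ i - φ (i + 1)) = 0 := by
  rw [← Finset.mul_sum]
  have := sum_zmod_sub_succ_of_lt φ (Nat.zero_le m)
  simp at this
  simp [this]

theorem HasRungAvoidingPresentation.map {V W : Type*} {M : SimpleGraph W} {R' : Set (Sym2 W)}
    (hM : HasRungAvoidingPresentation M R') {G : SimpleGraph V} {R : Set (Sym2 V)} (ψ : W ↪ V)
    (hadj : ∀ x y, G.Adj (ψ x) (ψ y) ↔ M.Adj x y)
    (hcov : ∀ u w, G.Adj u w → ∃ x y, u = ψ x ∧ w = ψ y) (hR : R = Sym2.map ψ '' R') :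
    HasRungAvoidingPresentation G R := by
  obtain ⟨ρ, _, n, t, h, hinj, hM, rfl, hflow⟩ := hM
  refine ⟨ρ, inferInstance, n, ψ ∘ t, ψ ∘ h, ?_, fun u v => ⟨fun huv => ?_, ?_⟩, ?_, ?_⟩
  · exact (Sym2.map.injective ψ.injective).comp hinj
  · obtain ⟨x, y, rfl, rfl⟩ := hcov u v huv
    obtain ⟨a, ha⟩ := (hM x y).1 ((hadj x y).1 huv)
    exact ⟨a, congrArg (Sym2.map ψ) ha⟩
  · rintro ⟨a, ha⟩
    rw [← SimpleGraph.mem_edgeSet, ← ha]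
    exact (hadj _ _).2 ((hM _ _).2 ⟨a, rfl⟩)
  · rw [hR]
    ext e
    constructor
    · rintro ⟨_, ⟨k, rfl⟩, rfl⟩
      exact ⟨k, rfl⟩
    · rintro ⟨k, rfl⟩
      exact ⟨_, ⟨k, rfl⟩, rfl⟩
  · intro s k₀ hk₀
    obtain ⟨c, hc, h⟩ := hflow s k₀ hk₀
    exact ⟨c, fun φ => hc (φ ∘ ψ), h⟩

theorem ZMod.add_one_ne_self {m : ℕ} (hm : 3 ≤ m) (i : ZMod m) : i + 1 ≠ i := by
  have : Fact (1 < m) := ⟨by omega⟩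
  simp

theorem ZMod.eq_of_sym2_succ_eq {m : ℕ} (hm : 3 ≤ m) {i j : ZMod m}
    (h : s(i, i + 1) = s(j, j + 1)) : i = j := by
  rcases Sym2.eq_iff.1 h with ⟨h, -⟩ | ⟨h, h'⟩
  · exact h
  · have h2 : ((2 : ℕ) : ZMod m) = 0 := by
      push_cast
      linear_combination h' - h
    rw [ZMod.natCast_eq_zero_iff] at h2
    have := Nat.le_of_dvd (by omega) h2
    omega

theorem ZMod.natCast_inj_of_lt {m a b : ℕ} (ha : a < m) (hb : b < m) (h : (a : ZMod m) = b) :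
    a = b := by
  rw [ZMod.natCast_eq_natCast_iff] at h
  exact h.eq_of_lt_of_lt ha hb

theorem genCircularModel_hasRungAvoidingPresentation {n m₀ m₁ : ℕ} {A B : Fin n → ℕ}
    (hm₀ : 3 ≤ m₀) (hm₁ : 3 ≤ m₁) (hA : StrictMono A) (hB : StrictMono B)
    (hAm : ∀ k, A k < m₀) (hBm : ∀ k, B k < m₁) :
    HasRungAvoidingPresentation (genCircularModel n m₀ m₁ A B)
      {e | ∃ k, e = s(Sum.inl (A k : ZMod m₀), Sum.inr (B k : ZMod m₁))} := by
  have : NeZero m₀ := ⟨by omega⟩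
  have : NeZero m₁ := ⟨by omega⟩
  refine ⟨ZMod m₀ ⊕ ZMod m₁, inferInstance, n,
    Sum.elim id fun k => Sum.inl (A k : ZMod m₀),
    Sum.elim (Sum.map (· + 1) (· + 1)) fun k => Sum.inr (B k : ZMod m₁), ?_, ?_, rfl, ?_⟩
  · rintro ((i | i) | i) ((j | j) | j) h <;> simp at h <;> simp
    · exact ZMod.eq_of_sym2_succ_eq hm₀ (Sym2.eq_iff.2 (by simpa using h))
    · exact ZMod.eq_of_sym2_succ_eq hm₁ (Sym2.eq_iff.2 (by simpa using h))
    · exact hA.injective (ZMod.natCast_inj_of_lt (hAm i) (hAm j) h.1)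
  · have key : ∀ x y, (genCircularModel n m₀ m₁ A B).Adj x y ↔ x ≠ y ∧ _ :=
      fun x y => SimpleGraph.fromRel_adj _ x y
    have h0 := ZMod.add_one_ne_self hm₀
    have h1 := ZMod.add_one_ne_self hm₁
    rintro (u | u) (v | v) <;> rw [key] <;> simp
    · constructor
      · rintro ⟨-, rfl | rfl⟩
        · exact ⟨u, .inl ⟨rfl, rfl⟩⟩
        · exact ⟨v, .inr ⟨rfl, rfl⟩⟩
      · rintro ⟨i, ⟨rfl, rfl⟩ | ⟨rfl, rfl⟩⟩
        · exact ⟨(h0 _).symm, .inl rfl⟩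
        · exact ⟨h0 _, .inr rfl⟩
    · simp only [eq_comm]
    · simp only [eq_comm]
    · constructor
      · rintro ⟨-, rfl | rfl⟩
        · exact ⟨u, .inl ⟨rfl, rfl⟩⟩
        · exact ⟨v, .inr ⟨rfl, rfl⟩⟩
      · rintro ⟨i, ⟨rfl, rfl⟩ | ⟨rfl, rfl⟩⟩
        · exact ⟨(h1 _).symm, .inl rfl⟩
        · exact ⟨h1 _, .inr rfl⟩
  · intro s k₀ hk₀
    obtain ⟨q, hq, hqn, hqs⟩ := exists_seq_avoiding_increments
      (fun k => if hk : k < n then s ⟨k, hk⟩ else 0) (n := n) k₀.2 (by simpa using hk₀)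
      (one_ne_zero (α := ZMod 3))
    rw [one_mul] at hqn
    set r : Fin n → ZMod 3 := fun k => q k - q (k + 1) with hr
    have hrsum : ∑ k, r k = 0 := by rw [hr, sum_increments, hqn, sub_self]
    refine ⟨Sum.elim
      (Sum.elim (fun i => q 0 - ∑ k, if A k < i.val + 1 then r k else 0)
        (fun j => - q 0 + ∑ k, if B k < j.val + 1 then r k else 0)) r, fun φ => ?_, ?_, ?_⟩
    · simp only [Fintype.sum_sum_type, Sum.elim_inl, Sum.elim_inr, id, Sum.map_inl, Sum.map_inr,
        sub_mul, add_mul, Finset.sum_sub_distrib, Finset.sum_add_distrib]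
      rw [sum_zmod_const_mul (fun i => φ (.inl i)), sum_zmod_const_mul (fun i => φ (.inr i)),
        sum_zmod_partialSum_mul (fun i => φ (.inl i)) hAm,
        sum_zmod_partialSum_mul (fun i => φ (.inr i)) hBm]
      simp only [mul_sub, Finset.sum_sub_distrib, ← Finset.sum_mul, hrsum]
      ring
    · rintro (i | j)
      · obtain ⟨p, hp⟩ := exists_sum_increments_eq q (i.val + 1) hA.monotone
        simp only [Sum.elim_inl, hr, hp, sub_sub_cancel]
        exact hq p
      · obtain ⟨p, hp⟩ := exists_sum_increments_eq q (j.val + 1) hB.monotone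
        simp only [Sum.elim_inl, Sum.elim_inr, hr, hp, neg_add_eq_sub, sub_sub_cancel_left]
        exact neg_ne_zero.2 (hq p)
    · intro k
      simpa using hqs k

theorem genMobiusModel_hasRungAvoidingPresentation {n m : ℕ} {A B : Fin n → ℕ}
    (hm : 3 ≤ m) (hA : StrictMono A) (hB : StrictMono B)
    (hAB : ∀ k l, A k < B l) (hBm : ∀ k, B k < m)
    (hdist : ∀ k, A k + 2 ≤ B k ∧ B k + 2 ≤ m + A k) :
    HasRungAvoidingPresentation (genMobiusModel n m A B)
      {e | ∃ k, e = s((A k : ZMod m), (B k : ZMod m))} := by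
  have : NeZero m := ⟨by omega⟩
  have hAm : ∀ k, A k < m := fun k => (hAB k k).trans (hBm k)
  have hrail : ∀ (i : ZMod m) k, s(i, i + 1) ≠ s((A k : ZMod m), (B k : ZMod m)) := by
    intro i k h
    obtain ⟨h1, h2⟩ := hdist k
    rcases Sym2.eq_iff.1 h with ⟨rfl, h⟩ | ⟨rfl, h⟩
    · have := ZMod.natCast_inj_of_lt (a := A k + 1) (by have := hBm k; omega) (hBm k)
        (by push_cast; exact h)
      omega
    · rcases lt_or_ge (B k + 1) m with hlt | hge
      · have := ZMod.natCast_inj_of_lt hlt (hAm k) (by push_cast; exact h)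
        omega
      · have hB1 : B k + 1 = m := by have := hBm k; omega
        have h0 : ((B k + 1 : ℕ) : ZMod m) = 0 := by rw [hB1]; simp
        have := ZMod.natCast_inj_of_lt (a := 0) (by omega) (hAm k)
          (by rw [← h]; push_cast at h0 ⊢; exact h0.symm)
        omega
  refine ⟨ZMod m, inferInstance, n, Sum.elim id fun k => (A k : ZMod m),
    Sum.elim (· + 1) fun k => (B k : ZMod m), ?_, ?_, rfl, ?_⟩
  · rintro (i | k) (j | l) h
    · exact congrArg _ (ZMod.eq_of_sym2_succ_eq hm h)
    · exact absurd h (hrail i l)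
    · exact absurd h.symm (hrail j k)
    · rcases Sym2.eq_iff.1 h with ⟨h, -⟩ | ⟨h, -⟩
      · exact congrArg _ (hA.injective (ZMod.natCast_inj_of_lt (hAm k) (hAm l) h))
      · exact absurd (ZMod.natCast_inj_of_lt (hAm k) (hBm l) h) (hAB k l).ne
  · have key : ∀ x y, (genMobiusModel n m A B).Adj x y ↔ x ≠ y ∧ _ :=
      fun x y => SimpleGraph.fromRel_adj _ x y
    have h0 := ZMod.add_one_ne_self hm
    have hne : ∀ k, (A k : ZMod m) ≠ (B k : ZMod m) :=
      fun k h => (hAB k k).ne (ZMod.natCast_inj_of_lt (hAm k) (hBm k) h)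
    intro u v
    rw [key]
    constructor
    · rintro ⟨-, (rfl | ⟨k, rfl, rfl⟩) | (rfl | ⟨k, rfl, rfl⟩)⟩
      · exact ⟨.inl u, rfl⟩
      · exact ⟨.inr k, rfl⟩
      · exact ⟨.inl v, Sym2.eq_swap⟩
      · exact ⟨.inr k, Sym2.eq_swap⟩
    · rintro ⟨i | k, h⟩ <;> rcases Sym2.eq_iff.1 h with ⟨rfl, rfl⟩ | ⟨rfl, rfl⟩
      · exact ⟨(h0 _).symm, .inl (.inl rfl)⟩
      · exact ⟨h0 _, .inr (.inl rfl)⟩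
      · exact ⟨hne k, .inl (.inr ⟨k, rfl, rfl⟩)⟩
      · exact ⟨(hne k).symm, .inr (.inr ⟨k, rfl, rfl⟩)⟩
  · intro s k₀ hk₀
    obtain ⟨q, hq, hqn, hqs⟩ := exists_seq_avoiding_increments
      (fun k => if hk : k < n then s ⟨k, hk⟩ else 0) (n := n) k₀.2 (by simpa using hk₀)
      (neg_ne_zero.2 (one_ne_zero (α := ZMod 3)))
    set r : Fin n → ZMod 3 := fun k => q k - q (k + 1) with hr
    refine ⟨Sum.elim (fun i => q 0 - (∑ k, if A k < i.val + 1 then r k else 0) +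
      ∑ k, if B k < i.val + 1 then r k else 0) r, fun φ => ?_, fun i => ?_, fun k => ?_⟩
    · simp only [Fintype.sum_sum_type, Sum.elim_inl, Sum.elim_inr, id,
        sub_mul, add_mul, Finset.sum_sub_distrib, Finset.sum_add_distrib]
      rw [sum_zmod_const_mul, sum_zmod_partialSum_mul φ hAm, sum_zmod_partialSum_mul φ hBm]
      simp only [mul_sub, Finset.sum_sub_distrib]
      ring
    · obtain ⟨p, hp⟩ := exists_sum_increments_eq q (i.val + 1) hA.monotone
      obtain ⟨p', hp'⟩ := exists_sum_increments_eq q (i.val + 1) hB.monotone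
      change ∑ k, (if A k < i.val + 1 then r k else 0) = _ at hp
      change ∑ k, (if B k < i.val + 1 then r k else 0) = _ at hp'
      by_cases hi : ∃ l, B l < i.val + 1
      · obtain ⟨l, hl⟩ := hi
        have hAall : (∑ k, if A k < i.val + 1 then r k else 0) = q 0 - q n := by
          rw [← sum_increments]
          exact Finset.sum_congr rfl fun k _ => if_pos ((hAB k l).trans hl)
        rw [Sum.elim_inl, hAall, hp', hqn, show q 0 - (q 0 - -1 * q 0) + (q 0 - q p') = - q p' by ring]
        exact neg_ne_zero.2 (hq p')
      · have hBnone : (∑ k, if B k < i.val + 1 then r k else 0) = 0 :=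
          Finset.sum_eq_zero fun k _ => if_neg fun h => hi ⟨k, h⟩
        rw [Sum.elim_inl, hBnone, hp, add_zero, sub_sub_cancel]
        exact hq p
    · simpa using hqs k

theorem IsGenClosedLadder.hasRungAvoidingPresentation {V : Type*} {G : SimpleGraph V}
    {R : Set (Sym2 V)} (hG : IsGenClosedLadder G R) : HasRungAvoidingPresentation G R := by
  rcases hG with ⟨n, m₀, m₁, A, B, ψ, hm₀, hm₁, hA, hB, hAm, hBm, hadj, hcov, rfl⟩ |
    ⟨n, m, A, B, ψ, hm, hA, hB, hAB, hBm, hdist, hadj, hcov, rfl⟩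
  · refine (genCircularModel_hasRungAvoidingPresentation hm₀ hm₁ hA hB hAm hBm).map ψ hadj hcov ?_
    ext e
    constructor
    · rintro ⟨k, rfl⟩
      exact ⟨_, ⟨k, rfl⟩, rfl⟩
    · rintro ⟨_, ⟨k, rfl⟩, rfl⟩
      exact ⟨k, rfl⟩
  · refine (genMobiusModel_hasRungAvoidingPresentation hm hA hB hAB hBm hdist).map ψ hadj hcov ?_
    ext e
    constructor
    · rintro ⟨k, rfl⟩
      exact ⟨_, ⟨k, rfl⟩, rfl⟩
    · rintro ⟨_, ⟨k, rfl⟩, rfl⟩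
      exact ⟨k, rfl⟩

theorem HasRungAvoidingPresentation.subset_edgeSet {V : Type*} {G : SimpleGraph V}
    {R : Set (Sym2 V)} (hG : HasRungAvoidingPresentation G R) : R ⊆ G.edgeSet := by
  obtain ⟨ρ, _, n, t, h, -, hadj, rfl, -⟩ := hG
  rintro _ ⟨k, rfl⟩
  exact (hadj _ _).2 ⟨_, rfl⟩

/-- `f` is an integer lift of `g` with values of absolute value less than three, vanishing where
`g` does. -/
structure IsSmallLift {V : Type*} (g : V → V → ZMod 3) (f : V → V → ℤ) : Prop where
  antisymm : ∀ u v, f u v = - f v u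
  cast_eq : ∀ u v, (f u v : ZMod 3) = g u v
  abs_lt : ∀ u v, |f u v| < 3
  eq_zero : ∀ u v, g u v = 0 → f u v = 0

/-- There is a path of length `k` in the support of the positive part of `f` from `u` to a
vertex of negative net outflow. -/
def ReachesDeficit {V : Type*} [Fintype V] (f : V → V → ℤ) : ℕ → V → Prop
  | 0, u => ∑ v, f u v < 0
  | k + 1, u => ∃ v, 0 < f u v ∧ ReachesDeficit f k v

open Classical in
/-- Subtract three units of flow along the arc from `a` to `b`. -/
noncomputable def pushArc {V : Type*} (f : V → V → ℤ) (a b u v : V) : ℤ :=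
  f u v - (if u = a ∧ v = b then 3 else 0) + (if u = b ∧ v = a then 3 else 0)

theorem IsSmallLift.pushArc {V : Type*} {g : V → V → ZMod 3} {f : V → V → ℤ}
    (hf : IsSmallLift g f) {a b : V} (hab : 0 < f a b) : IsSmallLift g (pushArc f a b) := by
  have hne : a ≠ b := by
    rintro rfl
    have := hf.antisymm a a
    omega
  refine ⟨fun u v => ?_, fun u v => ?_, fun u v => ?_, fun u v huv => ?_⟩
  · have := hf.antisymm u v
    simp only [_root_.pushArc]
    split_ifs <;> first | omega | (exfalso; tauto)
  · rw [← hf.cast_eq]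
    simp only [_root_.pushArc]
    split_ifs <;> push_cast <;> simp [show (3 : ZMod 3) = 0 by decide]
  · have h1 := hf.abs_lt u v
    have h2 := hf.antisymm u v
    rw [_root_.abs_lt] at h1 ⊢
    simp only [_root_.pushArc]
    split_ifs with h h' h'
    · exact absurd (h.1.symm.trans h'.1) hne
    · obtain ⟨rfl, rfl⟩ := h
      omega
    · obtain ⟨rfl, rfl⟩ := h'
      omega
    · omega
  · have h1 := hf.eq_zero u v huv
    have h2 := hf.antisymm u v
    simp only [_root_.pushArc]
    split_ifs with h h' h'
    · exact absurd (h.1.symm.trans h'.1) hne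
    · obtain ⟨rfl, rfl⟩ := h
      omega
    · obtain ⟨rfl, rfl⟩ := h'
      omega
    · omega

open Classical in
theorem sum_pushArc {V : Type*} [Fintype V] (f : V → V → ℤ) (a b u : V) :
    ∑ v, pushArc f a b u v =
      ∑ v, f u v - (if u = a then 3 else 0) + (if u = b then 3 else 0) := by
  simp only [pushArc, Finset.sum_add_distrib, Finset.sum_sub_distrib]
  congr 2
  · by_cases h : u = a <;> simp [h]
  · by_cases h : u = b <;> simp [h]

theorem IsSmallLift.three_dvd_sum {V : Type*} [Fintype V] {g : V → V → ZMod 3}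
    {f : V → V → ℤ} (hf : IsSmallLift g f) (hg : ∀ u, ∑ v, g u v = 0) (u : V) :
    (3 : ℤ) ∣ ∑ v, f u v := by
  rw [← Nat.cast_ofNat, ← ZMod.intCast_zmod_eq_zero_iff_dvd]
  simp [hf.cast_eq, hg]

theorem ReachesDeficit.pushArc {V : Type*} [Fintype V] {f : V → V → ℤ} {a b : V}
    (ha : 0 < ∑ v, f a v) (hb : ∑ v, f b v = 0) : ∀ {k : ℕ} {z : V}, ReachesDeficit f k z →
    ReachesDeficit (pushArc f a b) k z ∨ ∃ j ≤ k, ReachesDeficit f j a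
  | 0, z, hz => by
    left
    simp only [ReachesDeficit] at hz ⊢
    rw [sum_pushArc, if_neg, if_neg]
    · simpa using hz
    · rintro rfl; omega
    · rintro rfl; omega
  | k + 1, z, hz => by
    by_cases hza : z = a
    · exact .inr ⟨k + 1, le_rfl, hza ▸ hz⟩
    obtain ⟨v, hv, hkv⟩ := hz
    by_cases hva : v = a
    · exact .inr ⟨k, by omega, hva ▸ hkv⟩
    rcases ReachesDeficit.pushArc ha hb hkv with h | ⟨j, hj, h⟩
    · refine .inl ⟨v, ?_, h⟩
      simpa [_root_.pushArc, hza, hva] using hv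
    · exact .inr ⟨j, by omega, h⟩

/-- A path from a vertex of positive to a vertex of negative net outflow allows decreasing the
total imbalance. -/
theorem IsSmallLift.exists_smaller {V : Type*} [Fintype V] {g : V → V → ZMod 3}
    (hg : ∀ u, ∑ v, g u v = 0) (k : ℕ) : ∀ {f : V → V → ℤ} {a : V}, IsSmallLift g f →
    0 < ∑ v, f a v → ReachesDeficit f k a →
    ∃ f', IsSmallLift g f' ∧ ∑ u, |∑ v, f' u v| < ∑ u, |∑ v, f u v| := by
  classical
  induction k using Nat.strong_induction_on with
  | _ k ih =>
    intro f a hf ha hk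
    rcases k with _ | k
    · simp only [ReachesDeficit] at hk
      omega
    obtain ⟨b, hab, hkb⟩ := hk
    have hne : a ≠ b := by
      rintro rfl
      have := hf.antisymm a a
      omega
    have ha3 := hf.three_dvd_sum hg a
    have hb3 := hf.three_dvd_sum hg b
    have hsum : ∑ u, |∑ v, _root_.pushArc f a b u v| =
        ∑ u, |∑ v, f u v| - 3 + (|∑ v, f b v + 3| - |∑ v, f b v|) := by
      have h : ∑ u, (|∑ v, _root_.pushArc f a b u v| - |∑ v, f u v|) =
          -3 + (|∑ v, f b v + 3| - |∑ v, f b v|) := by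
        rw [Finset.sum_eq_add a b hne]
        · simp only [sum_pushArc, if_true, hne, hne.symm, if_false, add_zero, sub_zero]
          rw [abs_of_pos ha, abs_of_nonneg (a := ∑ v, f a v - 3) (by omega)]
          ring
        · intro u _ hu
          simp [sum_pushArc, hu.1, hu.2]
        · simp
        · simp
      rw [Finset.sum_sub_distrib] at h
      omega
    rcases lt_trichotomy (∑ v, f b v) 0 with hb | hb | hb
    · refine ⟨_, hf.pushArc hab, ?_⟩
      rw [hsum, abs_of_neg hb, abs_of_nonpos (by omega)]
      omega
    · rcases hkb.pushArc ha hb with h | ⟨j, hj, h⟩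
      · obtain ⟨f', hf', hlt⟩ := ih k (by omega) (hf.pushArc hab)
          (by rw [sum_pushArc]; simp [hne.symm, hb]) h
        refine ⟨f', hf', ?_⟩
        rw [hsum, hb] at hlt
        simpa using hlt
      · exact ih j (by omega) hf ha h
    · exact ih k (by omega) hf hb hkb

theorem sum_sum_eq_zero_of_antisymm {V : Type*} (s : Finset V) {f : V → V → ℤ}
    (hf : ∀ u v, f u v = - f v u) : ∑ u ∈ s, ∑ v ∈ s, f u v = 0 := by
  have h1 : ∑ u ∈ s, ∑ v ∈ s, f u v = - ∑ u ∈ s, ∑ v ∈ s, f u v := by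
    conv_lhs => rw [Finset.sum_comm]
    simp only [← Finset.sum_neg_distrib]
    exact Finset.sum_congr rfl fun u _ => Finset.sum_congr rfl fun v _ => hf v u
  omega

/-- If some vertex has positive net outflow, then a vertex of negative net outflow can be reached
from it along arcs of positive flow. -/
theorem exists_reachesDeficit {V : Type*} [Fintype V] {f : V → V → ℤ}
    (hf : ∀ u v, f u v = - f v u) {a : V} (ha : 0 < ∑ v, f a v) :
    ∃ k, ReachesDeficit f k a := by
  classical
  by_contra! hno
  set X : Finset V := {u | ¬ ∃ k, ReachesDeficit f k u} with hX
  have hmem : ∀ u, u ∈ X ↔ ¬ ∃ k, ReachesDeficit f k u := by simp [hX]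
  have h1 : 0 < ∑ u ∈ X, ∑ v, f u v := by
    refine Finset.sum_pos' (fun u hu => ?_) ⟨a, (hmem a).2 fun ⟨k, hk⟩ => hno k hk, ha⟩
    by_contra! h
    exact (hmem u).1 hu ⟨0, h⟩
  have h2 : ∑ u ∈ X, ∑ v, f u v = ∑ u ∈ X, ∑ v ∈ Xᶜ, f u v := by
    simp only [← Finset.sum_add_sum_compl X, Finset.sum_add_distrib]
    rw [sum_sum_eq_zero_of_antisymm X hf, zero_add]
  have h3 : ∑ u ∈ X, ∑ v ∈ Xᶜ, f u v ≤ 0 := by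
    refine Finset.sum_nonpos fun u hu => Finset.sum_nonpos fun v hv => ?_
    by_contra! h
    rw [Finset.mem_compl, hmem, not_not] at hv
    obtain ⟨k, hk⟩ := hv
    exact (hmem u).1 hu ⟨k + 1, v, h, hk⟩
  omega

/-- Tutte: a nowhere-zero flow modulo three lifts to a nowhere-zero `3`-flow. -/
theorem IsModFlowOn.hasNowhereZero3Flow {V : Type*} [Fintype V] {G : SimpleGraph V}
    {g : V → V → ZMod 3} (hg : IsModFlowOn G g) (hne : ∀ u v, G.Adj u v → g u v ≠ 0) :
    HasNowhereZero3Flow G := by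
  have hlift : IsSmallLift g fun u v => (g u v).valMinAbs := by
    refine ⟨fun u v => ?_, fun u v => ZMod.coe_valMinAbs _, fun u v => ?_, fun u v h => ?_⟩
    · rw [hg.antisymm u v]
      generalize g v u = x
      revert x
      decide
    · generalize g u v = x
      revert x
      decide
    · simp [h]
  obtain ⟨f, hf, hmin⟩ : ∃ f, IsSmallLift g f ∧ ∀ f', IsSmallLift g f' →
      ¬ (∑ u, |∑ v, f' u v|).toNat < (∑ u, |∑ v, f u v|).toNat := by
    have := (measure fun f : V → V → ℤ => (∑ u, |∑ v, f u v|).toNat).wf.has_min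
      {f | IsSmallLift g f} ⟨_, hlift⟩
    exact this
  have hnonpos : ∀ u, ∑ v, f u v ≤ 0 := by
    intro a
    by_contra! ha
    obtain ⟨k, hk⟩ := exists_reachesDeficit hf.antisymm ha
    obtain ⟨f', hf', hlt⟩ := IsSmallLift.exists_smaller hg.sum_eq_zero k hf ha hk
    have : 0 ≤ ∑ u, |∑ v, f' u v| := Finset.sum_nonneg fun _ _ => abs_nonneg _
    exact hmin f' hf' (by omega)
  refine ⟨f, hf.antisymm, fun u v huv => hf.eq_zero u v (hg.eq_zero u v huv),
    fun u v huv => ⟨abs_pos.2 fun h => hne u v huv ?_, hf.abs_lt u v⟩, fun u => ?_⟩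
  · rw [← hf.cast_eq, h, Int.cast_zero]
  · exact (Finset.sum_eq_zero_iff_of_nonpos fun u _ => hnonpos u).1
      (sum_sum_eq_zero_of_antisymm Finset.univ hf.antisymm) u (Finset.mem_univ u)

theorem intCast_zmod_three_ne_zero {x : ℤ} (h0 : 0 < |x|) (h3 : |x| < 3) : (x : ZMod 3) ≠ 0 := by
  intro h
  have := Int.le_of_dvd h0 ((dvd_abs _ _).2 ((ZMod.intCast_zmod_eq_zero_iff_dvd x 3).1 h))
  omega

/-- Flows on the members of a family of graphs can be chosen so that, added to a given
antisymmetric function `s`, they are nonzero on every edge in `E`, provided every member can adapt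
to prescriptions on `E` as soon as it is good or meets `E` in an edge where `s` is nonzero, and
every member that is not good has at least two edges in `E`. -/
theorem exists_family_add_sum_ne_zero {V ι : Type*} [Fintype V] {S : ι → SimpleGraph V}
    {E : Set (Sym2 V)} {Good : ι → Prop} (P : ι → (V → V → ZMod 3) → Prop)
    (hP : ∀ i g, P i g → IsModFlowOn (S i) g)
    (hadapt : ∀ i (s : V → V → ZMod 3), (∀ u v, s u v = - s v u) →
      (Good i ∨ ∃ u v, (S i).Adj u v ∧ s(u, v) ∈ E ∧ s u v ≠ 0) →
      ∃ g, P i g ∧ ∀ u v, (S i).Adj u v → s(u, v) ∈ E → s u v + g u v ≠ 0)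
    (htwo : ∀ i, ¬ Good i → ∀ X : Set (Sym2 V), X.Subsingleton →
      ∃ u v, (S i).Adj u v ∧ s(u, v) ∈ E ∧ s(u, v) ∉ X) :
    ∀ (J : Finset ι) (s : V → V → ZMod 3) (X : Set (Sym2 V)), (∀ u v, s u v = - s v u) →
      X.Subsingleton →
      (∀ u v, s(u, v) ∈ E → s u v = 0 → ∃ i ∈ J, (S i).Adj u v ∧
        (s(u, v) ∈ X ∨ ∃ j ∈ J, j ≠ i ∧ (S j).Adj u v)) →
      ∃ g : ι → V → V → ZMod 3, (∀ i ∈ J, P i (g i)) ∧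
        ∀ u v, s(u, v) ∈ E → s u v + ∑ i ∈ J, g i u v ≠ 0 := by
  classical
  intro J
  induction J using Finset.strongInduction with
  | _ J ih =>
  intro s X hs hX hJ
  have step : ∀ i ∈ J, ∀ (g : V → V → ZMod 3) (Y : Set (Sym2 V)), P i g → Y.Subsingleton →
      (∀ u v, s(u, v) ∈ E → s u v + g u v = 0 → ∃ k ∈ J.erase i, (S k).Adj u v ∧
        (s(u, v) ∈ Y ∨ ∃ j ∈ J.erase i, j ≠ k ∧ (S j).Adj u v)) →
      ∃ g : ι → V → V → ZMod 3, (∀ i ∈ J, P i (g i)) ∧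
        ∀ u v, s(u, v) ∈ E → s u v + ∑ i ∈ J, g i u v ≠ 0 := by
    intro i hi g Y hg hY hcond
    obtain ⟨g', hg', hne⟩ := ih (J.erase i) (Finset.erase_ssubset hi)
      (fun u v => s u v + g u v) Y
      (fun u v => by rw [hs u v, (hP i g hg).antisymm u v]; ring) hY hcond
    refine ⟨Function.update g' i g, fun j hj => ?_, fun u v he => ?_⟩
    · by_cases hji : j = i
      · subst hji
        simpa using hg
      · rw [Function.update_of_ne hji]
        exact hg' j (Finset.mem_erase.2 ⟨hji, hj⟩)
    · have := hne u v he
      rw [← Finset.add_sum_erase _ _ hi, Function.update_self,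
        Finset.sum_congr rfl fun j hj => by
          rw [Function.update_of_ne (Finset.ne_of_mem_erase hj)], ← add_assoc]
      exact this
  -- An edge outside `S i` keeps its value and the members containing it.
  have outside : ∀ i (g : V → V → ZMod 3), P i g → ∀ u v, ¬ (S i).Adj u v → s(u, v) ∈ E →
      s u v + g u v = 0 → ∃ k ∈ J.erase i, (S k).Adj u v ∧
        (s(u, v) ∈ X ∨ ∃ j ∈ J.erase i, j ≠ k ∧ (S j).Adj u v) := by
    intro i g hg u v hadj he h0
    rw [(hP i g hg).eq_zero u v hadj, add_zero] at h0
    obtain ⟨k, hk, hkadj, h⟩ := hJ u v he h0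
    have hmem : ∀ j ∈ J, (S j).Adj u v → j ∈ J.erase i :=
      fun j hj hjadj => Finset.mem_erase.2 ⟨by rintro rfl; exact hadj hjadj, hj⟩
    exact ⟨k, hmem k hk hkadj, hkadj,
      h.imp_right fun ⟨j, hj, hjk, hjadj⟩ => ⟨j, hmem j hj hjadj, hjk, hjadj⟩⟩
  by_cases hstart : ∃ i ∈ J, Good i ∨ ∃ u v, (S i).Adj u v ∧ s(u, v) ∈ E ∧ s u v ≠ 0
  · obtain ⟨i, hi, h⟩ := hstart
    obtain ⟨g, hg, hne⟩ := hadapt i s hs h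
    refine step i hi g X hg hX fun u v he h0 => ?_
    by_cases hadj : (S i).Adj u v
    · exact absurd h0 (hne u v hadj he)
    · exact outside i g hg u v hadj he h0
  push Not at hstart
  rcases J.eq_empty_or_nonempty with rfl | ⟨i₀, hi₀⟩
  · refine ⟨fun _ _ _ => 0, by simp, fun u v he h0 => ?_⟩
    obtain ⟨i, hi, -⟩ := hJ u v he (by simpa using h0)
    simp at hi
  obtain ⟨i, hi, hXi⟩ : ∃ i ∈ J, ∀ u v, s(u, v) ∈ E → s(u, v) ∈ X → s u v = 0 →
      (S i).Adj u v := by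
    by_cases hXE : ∃ u v, s(u, v) ∈ E ∧ s(u, v) ∈ X ∧ s u v = 0
    · obtain ⟨u, v, he, hx, h0⟩ := hXE
      obtain ⟨i, hi, hadj, -⟩ := hJ u v he h0
      refine ⟨i, hi, fun u' v' _ hx' _ => ?_⟩
      rw [← SimpleGraph.mem_edgeSet, hX hx' hx]
      exact hadj
    · exact ⟨i₀, hi₀, fun u v he hx h0 => absurd ⟨u, v, he, hx, h0⟩ hXE⟩
  obtain ⟨a, b, hab, habE, habX⟩ := htwo i (hstart i hi).1 X hX
  set s' : V → V → ZMod 3 := fun u v =>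
    if u = a ∧ v = b then 1 else if u = b ∧ v = a then -1 else s u v with hs'
  obtain ⟨g, hg, hne⟩ := hadapt i s' (fun u v => by
      have hne := hab.ne
      by_cases h1 : u = a ∧ v = b
      · obtain ⟨rfl, rfl⟩ := h1
        simp [hs', hne.symm]
      by_cases h2 : u = b ∧ v = a
      · obtain ⟨rfl, rfl⟩ := h2
        simp [hs', hne.symm]
      · simpa only [hs', if_neg h1, if_neg h2, if_neg (mt And.symm h1), if_neg (mt And.symm h2)]
          using hs u v)
    (.inr ⟨a, b, hab, habE, by simp [hs']⟩)
  refine step i hi g {s(a, b)} hg Set.subsingleton_singleton fun u v he h0 => ?_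
  by_cases hadj : (S i).Adj u v
  · by_cases huv : s(u, v) = s(a, b)
    · obtain ⟨k, hk, hkadj, h⟩ := hJ u v he ((hstart i hi).2 u v hadj he)
      rw [huv] at h ⊢
      obtain h | ⟨j, hj, hjk, hjadj⟩ := h
      · exact absurd h habX
      · by_cases hki : k = i
        · exact ⟨j, Finset.mem_erase.2 ⟨hki ▸ hjk, hj⟩, hjadj, .inl rfl⟩
        · exact ⟨k, Finset.mem_erase.2 ⟨hki, hk⟩, hkadj, .inl rfl⟩
    · refine absurd h0 ?_
      have := hne u v hadj he
      have h1 : ¬ (u = a ∧ v = b) := fun ⟨h, h'⟩ => huv (by rw [h, h'])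
      have h2 : ¬ (u = b ∧ v = a) := fun ⟨h, h'⟩ => huv (by rw [h, h', Sym2.eq_swap])
      rwa [show s' u v = s u v from (if_neg h1).trans (if_neg h2)] at this
  · obtain ⟨k, hk, hkadj, h⟩ := outside i g hg u v hadj he h0
    refine ⟨k, hk, hkadj, h.elim (fun hx => ?_) .inr⟩
    rw [(hP i g hg).eq_zero u v hadj, add_zero] at h0
    exact absurd (hXi u v he hx h0) hadj

/-- Let `Γ` be a finite simple graph, `S : ι → SimpleGraph V` an (injectively indexed)
family of distinct subgraphs whose union is `Γ`, with rung sets `R i`, and let `E` be a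
set of edges of `Γ` such that: each `S i` is a generalized closed ladder with rung set
`R i` in which every edge of `E(S i) ∩ E` is a rung, and `|E(S i) ∩ E| ≥ 2` whenever
`S i` has no nowhere-zero 3-flow; each edge of `E` is a rung of at least two distinct
members of the family; and each edge of `Γ` outside `E` lies in exactly one member.
Then `Γ` admits a nowhere-zero 3-flow. -/
theorem family_genClosedLadder_nowhere_zero_3_flow
    {V : Type*} [Fintype V] {ι : Type*} [Fintype ι]
    (Γ : SimpleGraph V) (S : ι → SimpleGraph V) (R : ι → Set (Sym2 V))
    (E : Set (Sym2 V)) (hE : E ⊆ Γ.edgeSet)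
    (hinj : Function.Injective S)
    (hcover : Γ = ⨆ i, S i)
    (hladder : ∀ i, IsGenClosedLadder (S i) (R i))
    (hrung : ∀ i, (S i).edgeSet ∩ E ⊆ R i)
    (htwo : ∀ i, ¬ HasNowhereZero3Flow (S i) → 2 ≤ ((S i).edgeSet ∩ E).ncard)
    (hE2 : ∀ e ∈ E, ∃ i j, i ≠ j ∧ e ∈ R i ∧ e ∈ R j)
    (huniq : ∀ e ∈ Γ.edgeSet \ E, ∃! i, e ∈ (S i).edgeSet) :
    HasNowhereZero3Flow Γ := by
  classical
  have hpres := fun i => (hladder i).hasRungAvoidingPresentation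
  have hadj : ∀ u v, Γ.Adj u v ↔ ∃ i, (S i).Adj u v := by
    intro u v
    rw [hcover, SimpleGraph.iSup_adj]
  have hadapt : ∀ i (s : V → V → ZMod 3), (∀ u v, s u v = - s v u) →
      (HasNowhereZero3Flow (S i) ∨ ∃ u v, (S i).Adj u v ∧ s(u, v) ∈ E ∧ s u v ≠ 0) →
      ∃ g, (IsModFlowOn (S i) g ∧ ∀ u v, (S i).Adj u v → s(u, v) ∉ E → g u v ≠ 0) ∧
        ∀ u v, (S i).Adj u v → s(u, v) ∈ E → s u v + g u v ≠ 0 := by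
    intro i s hs h
    by_cases hne : ∃ u v, (S i).Adj u v ∧ s(u, v) ∈ E ∧ s u v ≠ 0
    · obtain ⟨g, h1, h2, h3⟩ := (hpres i).exists_flow (hrung i) hs hne
      exact ⟨g, ⟨h1, h2⟩, h3⟩
    · obtain ⟨f, hf, hf0, hf3, hfs⟩ := h.resolve_right hne
      have hfne : ∀ u v, (S i).Adj u v → (f u v : ZMod 3) ≠ 0 :=
        fun u v huv => intCast_zmod_three_ne_zero (hf3 u v huv).1 (hf3 u v huv).2
      refine ⟨fun u v => f u v, ⟨⟨fun u v => ?_, fun u v huv => ?_, fun u => ?_⟩,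
        fun u v huv _ => hfne u v huv⟩, fun u v huv he => ?_⟩
      · rw [hf u v, Int.cast_neg]
      · rw [hf0 u v huv, Int.cast_zero]
      · rw [← Int.cast_sum, hfs, Int.cast_zero]
      · have h0 : s u v = 0 := by
          by_contra h0
          exact hne ⟨u, v, huv, he, h0⟩
        rw [h0, zero_add]
        exact hfne u v huv
  have hmeet : ∀ i, ¬ HasNowhereZero3Flow (S i) → ∀ X : Set (Sym2 V), X.Subsingleton →
      ∃ u v, (S i).Adj u v ∧ s(u, v) ∈ E ∧ s(u, v) ∉ X := by
    intro i hi X hX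
    obtain ⟨e, ⟨he, heE⟩, e', ⟨he', heE'⟩, hne⟩ := (Set.one_lt_ncard).1 (htwo i hi)
    by_cases heX : e ∈ X
    · have heX' : e' ∉ X := fun h => hne (hX heX h)
      induction e' with
      | _ u v => exact ⟨u, v, he', heE', heX'⟩
    · induction e with
      | _ u v => exact ⟨u, v, he, heE, heX⟩
  obtain ⟨g, hg, hgE⟩ := exists_family_add_sum_ne_zero
    (fun i g => IsModFlowOn (S i) g ∧ ∀ u v, (S i).Adj u v → s(u, v) ∉ E → g u v ≠ 0)
    (fun _ _ h => h.1) hadapt hmeet Finset.univ (fun _ _ => 0) ∅ (by simp)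
    Set.subsingleton_empty fun u v he _ => by
      obtain ⟨i, j, hij, hi, hj⟩ := hE2 _ he
      exact ⟨i, Finset.mem_univ i, (hpres i).subset_edgeSet hi,
        .inr ⟨j, Finset.mem_univ j, hij.symm, (hpres j).subset_edgeSet hj⟩⟩
  have hsum : IsModFlowOn Γ fun u v => ∑ i, g i u v := by
    refine ⟨fun u v => ?_, fun u v huv => Finset.sum_eq_zero fun i hi => ?_, fun u => ?_⟩
    · rw [← Finset.sum_neg_distrib]
      exact Finset.sum_congr rfl fun i hi => (hg i hi).1.antisymm u v
    · exact (hg i hi).1.eq_zero u v fun h => huv ((hadj u v).2 ⟨i, h⟩)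
    · rw [Finset.sum_comm]
      exact Finset.sum_eq_zero fun i hi => (hg i hi).1.sum_eq_zero u
  refine hsum.hasNowhereZero3Flow fun u v huv => ?_
  by_cases he : s(u, v) ∈ E
  · simpa using hgE u v he
  · obtain ⟨i, hi, huni⟩ := huniq s(u, v) ⟨huv, he⟩
    rw [Finset.sum_eq_single i]
    · exact (hg i (Finset.mem_univ i)).2 u v hi he
    · exact fun j hj hji => (hg j hj).1.eq_zero u v fun h => hji (huni j h)
    · simp
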